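/- arXiv:1512.01910 — 5 statements merged into one kernel-verified Lean document; each statement's English description precedes it below -/
import Mathlib

section
/- Let A, D ∈ ℂ^{n×n} and M ∈ ℂ^{k×k}. Then the matrix I_k ⊗ A − M ⊗ D (Kronecker products) is Hurwitz if and only if for every eigenvalue λ of M the matrix A − λ·D is Hurwitz. -/
open Matrix Filter
open scoped Kronecker

noncomputable section

/-- The complexification of a real matrix, taken entrywise. -/
def cplx {a b : Type*} (M : Matrix a b ℝ) : Matrix a b ℂ := M.map (algebraMap ℝ ℂ)

/-- A square complex matrix is Hurwitz if every eigenvalue has negative real part. -/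
def IsHurwitz {n : Type*} [Fintype n] [DecidableEq n] (M : Matrix n n ℂ) : Prop :=
  ∀ μ ∈ spectrum ℂ M, μ.re < 0

namespace Matrix

variable {m n : Type*} [Fintype m] [Fintype n]

lemma mem_spectrum_iff_exists_mulVec_eq_smul [DecidableEq n] {K : Type*} [Field K]
    {A : Matrix n n K} {μ : K} :
    μ ∈ spectrum K A ↔ ∃ v, v ≠ 0 ∧ A *ᵥ v = μ • v := by
  rw [← spectrum_toLin', ← Module.End.hasEigenvalue_iff_mem_spectrum]
  constructor
  · intro h
    obtain ⟨v, hv⟩ := h.exists_hasEigenvector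
    exact ⟨v, hv.2, by simpa using hv.apply_eq_smul⟩
  · rintro ⟨v, hv, h⟩
    exact Module.End.hasEigenvalue_of_hasEigenvector
      ⟨Module.End.mem_eigenspace_iff.2 (by simpa using h), hv⟩

lemma kronecker_one_mulVec_apply [DecidableEq n] {R : Type*} [CommSemiring R]
    (M : Matrix m m R) (v : m × n → R) (i : m) (j : n) :
    ((M ⊗ₖ (1 : Matrix n n R)) *ᵥ v) (i, j) = (M *ᵥ fun i' => v (i', j)) i := by
  simp [mulVec, dotProduct, Fintype.sum_prod_type, one_apply]

lemma one_kronecker_mulVec_apply [DecidableEq m] {R : Type*} [CommSemiring R]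
    (B : Matrix n n R) (v : m × n → R) (i : m) (j : n) :
    (((1 : Matrix m m R) ⊗ₖ B) *ᵥ v) (i, j) = (B *ᵥ fun j' => v (i, j')) j := by
  simp [mulVec, dotProduct, Fintype.sum_prod_type, one_apply, ite_mul, Finset.sum_ite_irrel]

lemma kronecker_mulVec_mul {R : Type*} [CommSemiring R] (M : Matrix m m R) (B : Matrix n n R)
    (u : m → R) (w : n → R) :
    ((M ⊗ₖ B) *ᵥ fun p => u p.1 * w p.2) = fun p => (M *ᵥ u) p.1 * (B *ᵥ w) p.2 := by
  ext ⟨i, j⟩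
  simp only [mulVec, dotProduct, Fintype.sum_prod_type, kronecker_apply, Finset.sum_mul_sum]
  exact Finset.sum_congr rfl fun _ _ => Finset.sum_congr rfl fun _ _ => by ring

/-- If two square matrices over an algebraically closed field commute, every eigenvalue of the
first has an eigenvector that is also an eigenvector of the second. -/
lemma exists_common_eigenvector_of_commute [DecidableEq n] {K : Type*} [Field K]
    [IsAlgClosed K] {A B : Matrix n n K} (h : Commute A B) {z : K} (hz : z ∈ spectrum K A) :
    ∃ (μ : K) (v : n → K), v ≠ 0 ∧ A *ᵥ v = z • v ∧ B *ᵥ v = μ • v := by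
  rw [← spectrum_toLin', ← Module.End.hasEigenvalue_iff_mem_spectrum] at hz
  have hcomm : Commute (toLin' A) (toLin' B) := by
    rw [commute_iff_eq, Module.End.mul_eq_comp, Module.End.mul_eq_comp, ← toLin'_mul,
      ← toLin'_mul, h.eq]
  have hmaps := Module.End.mapsTo_genEigenspace_of_comm hcomm z 1
  have : Nontrivial (Module.End.eigenspace (toLin' A) z) :=
    Submodule.nontrivial_iff_ne_bot.2 hz
  obtain ⟨μ, hμ⟩ := Module.End.exists_eigenvalue ((toLin' B).restrict hmaps)
  obtain ⟨v, hv⟩ := hμ.exists_hasEigenvector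
  refine ⟨μ, v, fun h0 => hv.2 (Subtype.ext h0), ?_, ?_⟩
  · simpa using Module.End.mem_eigenspace_iff.1 v.2
  · exact congrArg Subtype.val hv.apply_eq_smul

/-- The spectrum of `1 ⊗ A - M ⊗ D` is the union of the spectra of `A - μ • D` over the
eigenvalues `μ` of `M`. -/
lemma mem_spectrum_one_kronecker_sub_kronecker_iff [DecidableEq m] [DecidableEq n]
    {K : Type*} [Field K] [IsAlgClosed K]
    {A D : Matrix n n K} {M : Matrix m m K} {z : K} :
    z ∈ spectrum K ((1 : Matrix m m K) ⊗ₖ A - M ⊗ₖ D) ↔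
      ∃ μ ∈ spectrum K M, z ∈ spectrum K (A - μ • D) := by
  constructor
  · intro hz
    have hcomm : Commute ((1 : Matrix m m K) ⊗ₖ A - M ⊗ₖ D) (M ⊗ₖ (1 : Matrix n n K)) := by
      simp [commute_iff_eq, sub_mul, mul_sub, ← mul_kronecker_mul]
    obtain ⟨μ, v, hv, hAv, hMv⟩ := exists_common_eigenvector_of_commute hcomm hz
    have hMD : M ⊗ₖ D = ((1 : Matrix m m K) ⊗ₖ D) * (M ⊗ₖ (1 : Matrix n n K)) := by
      simp [← mul_kronecker_mul]
    obtain ⟨⟨i, j⟩, hij⟩ := Function.ne_iff.1 hv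
    refine ⟨μ, mem_spectrum_iff_exists_mulVec_eq_smul.2 ⟨fun i' => v (i', j), ?_, ?_⟩,
      mem_spectrum_iff_exists_mulVec_eq_smul.2 ⟨fun j' => v (i, j'), ?_, ?_⟩⟩
    · exact fun h => hij (congrFun h i)
    · ext i'
      rw [← kronecker_one_mulVec_apply, hMv]
      rfl
    · exact fun h => hij (congrFun h j)
    · ext j'
      have := congrFun hAv (i, j')
      rw [hMD, sub_mulVec, ← mulVec_mulVec, hMv, mulVec_smul] at this
      simpa [one_kronecker_mulVec_apply, sub_mulVec, smul_mulVec] using this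
  · rintro ⟨μ, hμ, hz⟩
    obtain ⟨u, hu, hMu⟩ := mem_spectrum_iff_exists_mulVec_eq_smul.1 hμ
    obtain ⟨w, hw, hAw⟩ := mem_spectrum_iff_exists_mulVec_eq_smul.1 hz
    obtain ⟨i, hi⟩ := Function.ne_iff.1 hu
    obtain ⟨j, hj⟩ := Function.ne_iff.1 hw
    refine mem_spectrum_iff_exists_mulVec_eq_smul.2 ⟨fun p => u p.1 * w p.2, ?_, ?_⟩
    · exact fun h => mul_ne_zero hi hj (congrFun h (i, j))
    · ext ⟨i', j'⟩
      have := congrFun hAw j'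
      simp only [sub_mulVec, smul_mulVec, Pi.sub_apply, Pi.smul_apply, smul_eq_mul] at this
      simp only [sub_mulVec, kronecker_mulVec_mul, hMu, one_mulVec, Pi.sub_apply, Pi.smul_apply,
        smul_eq_mul]
      linear_combination u i' * this

end Matrix

theorem kronecker_hurwitz_iff_forall_eigenvalue
    {n k : ℕ} (A D : Matrix (Fin n) (Fin n) ℂ) (M : Matrix (Fin k) (Fin k) ℂ) :
    IsHurwitz ((1 : Matrix (Fin k) (Fin k) ℂ) ⊗ₖ A - M ⊗ₖ D) ↔
      ∀ μ ∈ spectrum ℂ M, IsHurwitz (A - μ • D) := by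
  simp only [IsHurwitz, Matrix.mem_spectrum_one_kronecker_sub_kronecker_iff]
  exact ⟨fun h μ hμ z hz => h z ⟨μ, hμ, hz⟩, fun h z ⟨μ, hμ, hz⟩ => h μ hμ z hz⟩
end
end

section
/- Let N ≥ 3 be an odd natural number and let p ∈ ℂ. Then there exists a real matrix L ∈ ℝ^{N×N} with L·1_N = 0 whose characteristic polynomial (over ℂ) equals X · ((X − p)(X − p̄))^{(N−1)/2}, where p̄ is the complex conjugate of p; equivalently, the spectrum of L consists of the eigenvalue 0 together with p and p̄ each with multiplicity (N−1)/2. -/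
open Matrix Filter
open scoped Kronecker

noncomputable section

namespace Matrix

open Polynomial

theorem charpoly_blockDiagonal {R m o : Type*} [CommRing R] [Fintype m] [DecidableEq m]
    [Fintype o] [DecidableEq o] (M : o → Matrix m m R) :
    (blockDiagonal M).charpoly = ∏ k, (M k).charpoly := by
  have h : (blockDiagonal M).charmatrix = blockDiagonal fun k => (M k).charmatrix := by
    ext ⟨i, k⟩ ⟨j, l⟩ : 2
    by_cases hkl : k = l
    · subst hkl
      simp [charmatrix_apply, blockDiagonal_apply, diagonal_apply]
    · simp [blockDiagonal_apply, hkl]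
  simp only [charpoly, h, det_blockDiagonal]

/-- The real matrix with eigenvalues `p` and its conjugate. -/
def conjPair (p : ℂ) : Matrix (Fin 2) (Fin 2) ℝ := !![p.re, -p.im; p.im, p.re]

theorem charpoly_map_conjPair (p : ℂ) :
    ((conjPair p).map (algebraMap ℝ ℂ)).charpoly =
      (X - C p) * (X - C (starRingEnd ℂ p)) := by
  have hre : ((p.re : ℂ) + p.re) = p + starRingEnd ℂ p := by
    rw [Complex.add_conj]; push_cast; ring
  have hnorm : (p.re : ℂ) * p.re + p.im * p.im = p * starRingEnd ℂ p := by
    rw [Complex.mul_conj, Complex.normSq_apply]; push_cast; ring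
  rw [charpoly_fin_two]
  simp only [conjPair, trace_fin_two, det_fin_two, map_apply, of_apply, cons_val', cons_val_zero,
    cons_val_one, cons_val_fin_one, Complex.coe_algebraMap, Complex.ofReal_neg, neg_mul,
    sub_neg_eq_add, hre, hnorm, C_add, C_mul]
  ring

/-- `A` bordered by a zero row and a column that makes every row sum vanish. -/
def zeroRowSumExtension {R m : Type*} [Ring R] [Fintype m] (A : Matrix m m R) :
    Matrix (Unit ⊕ m) (Unit ⊕ m) R :=
  fromBlocks 0 0 (of fun i _ => -∑ j, A i j) A

theorem zeroRowSumExtension_mulVec_one {R m : Type*} [Ring R] [Fintype m] (A : Matrix m m R) :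
    zeroRowSumExtension A *ᵥ (fun _ => 1) = 0 := by
  ext (i | i) <;> simp [zeroRowSumExtension, mulVec, dotProduct]

theorem zeroRowSumExtension_map {R S m : Type*} [Ring R] [Ring S] [Fintype m]
    (f : R →+* S) (A : Matrix m m R) :
    (zeroRowSumExtension A).map f = zeroRowSumExtension (A.map f) := by
  ext (i | i) (j | j) <;> simp [zeroRowSumExtension]

theorem charpoly_zeroRowSumExtension {R m : Type*} [CommRing R] [Fintype m] [DecidableEq m]
    (A : Matrix m m R) : (zeroRowSumExtension A).charpoly = X * A.charpoly := by
  rw [zeroRowSumExtension, charpoly_fromBlocks_zero₁₂, charpoly_zero]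
  simp

end Matrix

open Polynomial in
theorem exists_interconnection_matrix_with_conj_pair_spectrum
    (N : ℕ) (hN : 3 ≤ N) (hNo : Odd N) (p : ℂ) :
    ∃ L : Matrix (Fin N) (Fin N) ℝ,
      L *ᵥ (fun _ => (1 : ℝ)) = 0 ∧
      (cplx L).charpoly =
        X * ((X - Polynomial.C p) * (X - Polynomial.C (starRingEnd ℂ p))) ^ ((N - 1) / 2) := by
  obtain ⟨k, rfl⟩ := hNo
  let e : Unit ⊕ (Fin 2 × Fin k) ≃ Fin (2 * k + 1) :=
    Fintype.equivFinOfCardEq (by simp [add_comm])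
  let A : Matrix (Fin 2 × Fin k) (Fin 2 × Fin k) ℝ := blockDiagonal fun _ => conjPair p
  refine ⟨reindex e e (zeroRowSumExtension A), ?_, ?_⟩
  · rw [reindex_apply, submatrix_mulVec_equiv]
    ext i
    exact congrFun (zeroRowSumExtension_mulVec_one A) (e.symm i)
  · have hmap : cplx (reindex e e (zeroRowSumExtension A)) =
        reindex e e (zeroRowSumExtension
          (blockDiagonal fun _ => (conjPair p).map (algebraMap ℝ ℂ))) := by
      rw [← blockDiagonal_map _ _ (map_zero _), ← zeroRowSumExtension_map]
      rfl
    rw [hmap, charpoly_reindex, charpoly_zeroRowSumExtension, charpoly_blockDiagonal]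
    simp only [charpoly_map_conjPair]
    simp
end
end

section
/- Let A, H ∈ ℂ^{n×n}, where H is positive semidefinite and the kernel of H contains no eigenvector of A corresponding to an eigenvalue with nonnegative real part (i.e., for all λ ∈ ℂ and nonzero v ∈ ℂ^n, if A·v = λ·v and H·v = 0 then Re λ < 0). Then A is Hurwitz if and only if there exists a positive semidefinite matrix P ∈ ℂ^{n×n} such that A*·P + P·A = −H, where A* denotes the conjugate transpose of A. -/
open Matrix Filter
open scoped Kronecker ComplexOrder

noncomputable section

/-- The powers of an element of a complex Banach algebra whose spectrum lies in the open unit disc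
decay at least geometrically. -/
theorem exists_eventually_norm_pow_le_of_spectrum {R : Type*} [NormedRing R] [NormedAlgebra ℂ R]
    [CompleteSpace R] {b : R} (hb : ∀ z ∈ spectrum ℂ b, ‖z‖ < 1) :
    ∃ r : ℝ, 0 ≤ r ∧ r < 1 ∧ ∀ᶠ k : ℕ in atTop, ‖b ^ k‖ ≤ r ^ k := by
  cases subsingleton_or_nontrivial R with
  | inl hR =>
    refine ⟨0, le_rfl, zero_lt_one, Eventually.of_forall fun k => ?_⟩
    rw [Subsingleton.elim (b ^ k) 0, norm_zero]
    positivity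
  | inr hR =>
    have hrad : spectralRadius ℂ b < ((1 : NNReal) : ENNReal) :=
      spectrum.spectralRadius_lt_of_forall_lt b fun z hz => hb z hz
    obtain ⟨r, hr, hr1⟩ := ENNReal.lt_iff_exists_nnreal_btwn.mp hrad
    refine ⟨r, r.2, by exact_mod_cast hr1, ?_⟩
    filter_upwards [(spectrum.pow_nnnorm_pow_one_div_tendsto_nhds_spectralRadius
      b).eventually_lt_const hr, eventually_gt_atTop 0] with k hk hk0
    have hk0' : (k : ℝ) ≠ 0 := by positivity
    have h := ENNReal.rpow_le_rpow hk.le (Nat.cast_nonneg (α := ℝ) k)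
    rw [← ENNReal.rpow_mul, one_div_mul_cancel hk0', ENNReal.rpow_one,
      ENNReal.rpow_natCast] at h
    exact_mod_cast h

/-- The Stein equation `p = q + b⋆ p b` has a nonnegative solution when `q` is nonnegative and the
spectrum of `b` lies in the open unit disc. -/
theorem exists_nonneg_stein_solution {R : Type*} [CStarAlgebra R] [PartialOrder R]
    [StarOrderedRing R] {b q : R} (hb : ∀ z ∈ spectrum ℂ b, ‖z‖ < 1) (hq : 0 ≤ q) :
    ∃ p : R, 0 ≤ p ∧ p = q + star b * p * b := by
  obtain ⟨r, hr0, hr1, hr⟩ := exists_eventually_norm_pow_le_of_spectrum hb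
  set f : ℕ → R := fun k => star (b ^ k) * q * b ^ k with hf
  have hsum : Summable f := by
    have hg : Summable fun k : ℕ => ‖q‖ * (r ^ 2) ^ k :=
      (summable_geometric_of_lt_one (by positivity) (by nlinarith)).mul_left _
    refine hg.of_norm_bounded_eventually_nat ?_
    filter_upwards [hr] with k hk
    calc ‖star (b ^ k) * q * b ^ k‖ ≤ ‖star (b ^ k)‖ * ‖q‖ * ‖b ^ k‖ :=
          norm_mul₃_le
      _ = ‖q‖ * ‖b ^ k‖ ^ 2 := by rw [norm_star]; ring
      _ ≤ ‖q‖ * (r ^ k) ^ 2 := by gcongr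
      _ = ‖q‖ * (r ^ 2) ^ k := by rw [← pow_mul, ← pow_mul, mul_comm k]
  refine ⟨∑' k, f k, tsum_nonneg fun k => star_left_conjugate_nonneg hq _, ?_⟩
  rw [← hsum.tsum_mul_left, ← (hsum.mul_left _).tsum_mul_right, hsum.tsum_eq_zero_add]
  have hstep (k : ℕ) : f (k + 1) = star b * f k * b := by
    simp only [hf, pow_succ, star_mul, mul_assoc]
  simp only [hstep]
  simp [hf]

/-- The Cayley transform maps the open left half-plane into the open unit disc. -/
theorem norm_lt_one_of_mem_spectrum_cayley {R : Type*} [Ring R] [Algebra ℂ R] {a : R}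
    (ha : ∀ z ∈ spectrum ℂ a, z.re < 0) (u : Rˣ) (hu : (u : R) = a - 1) {z : ℂ}
    (hz : z ∈ spectrum ℂ ((a + 1) * ↑u⁻¹)) : ‖z‖ < 1 := by
  have hfac : algebraMap ℂ R z - (a + 1) * ↑u⁻¹ = (z • (a - 1) - (a + 1)) * ↑u⁻¹ := by
    rw [sub_mul, smul_mul_assoc, ← hu, Units.mul_inv, Algebra.algebraMap_eq_smul_one]
  rw [spectrum.mem_iff, hfac, Units.isUnit_mul_units] at hz
  by_cases hz1 : z = 1
  · refine absurd ?_ hz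
    have h2 : z • (a - 1) - (a + 1) = algebraMap ℂ R (-2) := by
      rw [hz1, Algebra.algebraMap_eq_smul_one]
      module
    rw [h2]
    exact (IsUnit.mk0 (-2 : ℂ) (by norm_num)).map _
  · have hz1' : z - 1 ≠ 0 := sub_ne_zero.mpr hz1
    have hmem : (z + 1) / (z - 1) ∈ spectrum ℂ a := by
      rw [spectrum.mem_iff]
      intro h
      refine hz ?_
      have h2 : z • (a - 1) - (a + 1) =
          algebraMap ℂ R (-(z - 1)) * (algebraMap ℂ R ((z + 1) / (z - 1)) - a) := by
        rw [mul_sub, ← map_mul, neg_mul, mul_div_cancel₀ _ hz1', ← Algebra.smul_def,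
          Algebra.algebraMap_eq_smul_one]
        module
      rw [h2]
      exact ((IsUnit.mk0 _ (neg_ne_zero.mpr hz1')).map _).mul h
    have hre := ha _ hmem
    have hpos : 0 < Complex.normSq (z - 1) := Complex.normSq_pos.mpr hz1'
    rw [Complex.div_re, ← add_div, div_neg_iff] at hre
    have hlt : Complex.normSq z < 1 := by
      rcases hre with h | h
      · linarith [h.2]
      · have := h.1
        simp only [Complex.add_re, Complex.sub_re, Complex.one_re, Complex.add_im,
          Complex.sub_im, Complex.one_im] at this
        rw [Complex.normSq_apply]
        linarith
    rw [Complex.normSq_eq_norm_sq] at hlt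
    nlinarith [norm_nonneg z]

/-- The Lyapunov equation `a⋆ p + p a = -h` has a nonnegative solution when `h` is nonnegative and
the spectrum of `a` lies in the open left half-plane. -/
theorem exists_nonneg_lyapunov_solution {R : Type*} [CStarAlgebra R] [PartialOrder R]
    [StarOrderedRing R] {a h : R} (ha : ∀ z ∈ spectrum ℂ a, z.re < 0) (hh : 0 ≤ h) :
    ∃ p : R, 0 ≤ p ∧ star a * p + p * a = -h := by
  obtain ⟨u, hu⟩ : IsUnit (a - 1) := by
    have h1 : (1 : ℂ) ∉ spectrum ℂ a := fun h1 => by simpa using (ha 1 h1).trans zero_lt_one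
    rw [spectrum.notMem_iff, map_one] at h1
    simpa using h1.neg
  obtain ⟨p, hp, hpq⟩ := exists_nonneg_stein_solution
    (fun z hz => norm_lt_one_of_mem_spectrum_cayley ha u hu hz)
    (star_left_conjugate_nonneg (add_nonneg hh hh) (↑u⁻¹ : R))
  refine ⟨p, hp, ?_⟩
  have hinv : (↑u⁻¹ : R) * (a - 1) = 1 := by rw [← hu, Units.inv_mul]
  have hinv' : star (a - 1) * star (↑u⁻¹ : R) = 1 := by rw [← star_mul, hinv, star_one]
  have key : star (a - 1) * p * (a - 1) = (h + h) + star (a + 1) * p * (a + 1) := by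
    calc star (a - 1) * p * (a - 1)
        = star (a - 1) * (star (↑u⁻¹ : R) * (h + h) * ↑u⁻¹ +
            star ((a + 1) * ↑u⁻¹) * p * ((a + 1) * ↑u⁻¹)) * (a - 1) := by rw [← hpq]
      _ = (star (a - 1) * star (↑u⁻¹ : R)) * (h + h) * (↑u⁻¹ * (a - 1)) +
            (star (a - 1) * star (↑u⁻¹ : R)) * (star (a + 1) * p * (a + 1)) *
              (↑u⁻¹ * (a - 1)) := by rw [star_mul]; noncomm_ring
      _ = _ := by rw [hinv, hinv']; simp
  have h2 : (2 : ℂ) • (star a * p + p * a) = (2 : ℂ) • (-h) := by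
    rw [star_sub, star_add, star_one] at key
    have e : (star a - 1) * p * (a - 1) - (star a + 1) * p * (a + 1) = h + h :=
      sub_eq_of_eq_add key
    have e' : (star a - 1) * p * (a - 1) - (star a + 1) * p * (a + 1) =
        -((star a * p + p * a) + (star a * p + p * a)) := by noncomm_ring
    rw [two_smul, two_smul, ← neg_add, ← e, e', neg_neg]
  exact smul_right_injective R (two_ne_zero' ℂ) h2

/-- If `A⋆ P + P A = -H` with `P` and `H` positive semidefinite, then `H` annihilates every
eigenvector of `A` whose eigenvalue has nonnegative real part. -/
theorem mulVec_eq_zero_of_lyapunov {n : Type*} [Fintype n] {A H P : Matrix n n ℂ}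
    (hH : H.PosSemidef) (hP : P.PosSemidef) (hAP : Aᴴ * P + P * A = -H) {μ : ℂ} {v : n → ℂ}
    (hv : A *ᵥ v = μ • v) (hμ : 0 ≤ μ.re) : H *ᵥ v = 0 := by
  have hsum : star v ⬝ᵥ ((Aᴴ * P + P * A) *ᵥ v) = (star μ + μ) * (star v ⬝ᵥ (P *ᵥ v)) := by
    rw [add_mulVec, dotProduct_add, ← mulVec_mulVec, ← mulVec_mulVec, hv, dotProduct_mulVec,
      ← star_mulVec, hv, star_smul, smul_dotProduct, mulVec_smul, dotProduct_smul, smul_eq_mul,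
      smul_eq_mul, add_mul]
  rw [hAP, neg_mulVec, dotProduct_neg] at hsum
  have hμ' : 0 ≤ star μ + μ := by
    rw [add_comm, Complex.star_def, Complex.add_conj]
    exact_mod_cast mul_nonneg zero_le_two hμ
  have hle : star v ⬝ᵥ (H *ᵥ v) ≤ 0 :=
    neg_nonneg.mp (hsum ▸ mul_nonneg hμ' (hP.dotProduct_mulVec_nonneg v))
  exact (hH.dotProduct_mulVec_zero_iff v).mp (hle.antisymm (hH.dotProduct_mulVec_nonneg v))

open scoped MatrixOrder Matrix.Norms.L2Operator in
/-- The Lyapunov equation of a Hurwitz matrix has a positive semidefinite solution. -/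
theorem IsHurwitz.exists_posSemidef_lyapunov_solution {n : Type*} [Fintype n] [DecidableEq n]
    {A H : Matrix n n ℂ} (hA : IsHurwitz A) (hH : H.PosSemidef) :
    ∃ P : Matrix n n ℂ, P.PosSemidef ∧ Aᴴ * P + P * A = -H := by
  obtain ⟨P, hP, hAP⟩ := exists_nonneg_lyapunov_solution hA hH.nonneg
  exact ⟨P, hP.posSemidef, hAP⟩

theorem hurwitz_iff_exists_psd_lyapunov_solution
    {n : ℕ} (A H : Matrix (Fin n) (Fin n) ℂ) (hH : H.PosSemidef)
    (hker : ∀ (μ : ℂ) (v : Fin n → ℂ), v ≠ 0 → A *ᵥ v = μ • v → H *ᵥ v = 0 → μ.re < 0) :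
    IsHurwitz A ↔
      ∃ P : Matrix (Fin n) (Fin n) ℂ, P.PosSemidef ∧ Aᴴ * P + P * A = -H := by
  refine ⟨fun hA => hA.exists_posSemidef_lyapunov_solution hH, ?_⟩
  rintro ⟨P, hP, hAP⟩ μ hμ
  rw [← spectrum_toLin', ← Module.End.hasEigenvalue_iff_mem_spectrum] at hμ
  obtain ⟨v, hv⟩ := hμ.exists_hasEigenvector
  have hAv : A *ᵥ v = μ • v := by simpa using hv.apply_eq_smul
  by_contra! hre
  exact hre.not_gt (hker μ v hv.2 hAv (mulVec_eq_zero_of_lyapunov hH hP hAP hAv hre))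
end
end

section
/- Let D be a monic real polynomial of degree 2 and let N be a real polynomial of degree at most 1. Suppose there exists z ∈ ℂ such that every complex root of the polynomial D + z·N has negative real part. Then there exists a nonzero real number k such that every complex root of D + k·N has negative real part. -/
open Matrix Filter
open scoped Kronecker

noncomputable section

/-- A real monic quadratic with positive coefficients has its roots in the open left half-plane. -/
theorem re_neg_of_quadratic_eq_zero {p r : ℝ} (hp : 0 < p) (hr : 0 < r) {μ : ℂ}
    (h : μ ^ 2 + p * μ + r = 0) : μ.re < 0 := by
  have h1 := congrArg Complex.re h
  have h2 := congrArg Complex.im h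
  simp [pow_two] at h1 h2
  by_contra! hm
  have h3 : μ.im * (2 * μ.re + p) = 0 := by linarith
  rcases mul_eq_zero.1 h3 with h4 | h4
  · rw [h4] at h1
    nlinarith [mul_nonneg hp.le hm, mul_self_nonneg μ.re]
  · linarith

/-- If a monic complex quadratic has its roots in the open left half-plane, and the imaginary
parts of its coefficients have nonpositive product, then their real parts are positive. -/
theorem quadratic_coeff_re_pos {B C : ℂ} (h : ∀ μ : ℂ, μ ^ 2 + B * μ + C = 0 → μ.re < 0)
    (hBC : B.im * C.im ≤ 0) : 0 < B.re ∧ 0 < C.re := by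
  obtain ⟨w, hw⟩ := IsAlgClosed.exists_pow_nat_eq (B ^ 2 - 4 * C) (n := 2) (by norm_num)
  obtain ⟨μ, hμ⟩ : ∃ μ : ℂ, μ = (-B + w) / 2 := ⟨_, rfl⟩
  obtain ⟨ν, hν⟩ : ∃ ν : ℂ, ν = (-B - w) / 2 := ⟨_, rfl⟩
  have hμ0 : μ.re < 0 := h μ (by rw [hμ]; linear_combination hw / 4)
  have hν0 : ν.re < 0 := h ν (by rw [hν]; linear_combination hw / 4)
  have hB : B = -(μ + ν) := by rw [hμ, hν]; ring
  have hC : C = μ * ν := by rw [hμ, hν]; linear_combination hw / 4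
  subst hB hC
  simp only [Complex.neg_re, Complex.neg_im, Complex.add_re, Complex.add_im, Complex.mul_re,
    Complex.mul_im] at hBC ⊢
  refine ⟨by linarith, ?_⟩
  have h1 : μ.im * ν.im ≤ 0 := by
    by_contra! hv
    nlinarith [mul_nonneg_of_nonpos_of_nonpos hμ0.le (neg_nonpos.2 (sq_nonneg ν.im)),
      mul_nonneg_of_nonpos_of_nonpos hν0.le (neg_nonpos.2 (sq_nonneg μ.im)),
      mul_neg_of_neg_of_pos hμ0 hv, mul_neg_of_neg_of_pos hν0 hv]
  linarith [mul_pos_of_neg_of_neg hμ0 hν0]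

/-- Two lines with positive slopes are simultaneously positive at some positive point. -/
theorem exists_pos_add_mul_pos (a b : ℝ) {c d : ℝ} (hc : 0 < c) (hd : 0 < d) :
    ∃ k : ℝ, 0 < k ∧ 0 < a + k * c ∧ 0 < b + k * d := by
  have h1 : Tendsto (fun k : ℝ => a + k * c) atTop atTop :=
    tendsto_atTop_add_const_left _ _ (tendsto_id.atTop_mul_const hc)
  have h2 : Tendsto (fun k : ℝ => b + k * d) atTop atTop :=
    tendsto_atTop_add_const_left _ _ (tendsto_id.atTop_mul_const hd)
  exact ((eventually_gt_atTop 0).and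
    ((h1.eventually_gt_atTop 0).and (h2.eventually_gt_atTop 0))).exists

/-- Two affine functions positive at a common point are so at a common nonzero point. -/
theorem exists_ne_zero_add_mul_pos {a b c d x : ℝ} (h1 : 0 < a + x * c) (h2 : 0 < b + x * d) :
    ∃ k : ℝ, k ≠ 0 ∧ 0 < a + k * c ∧ 0 < b + k * d := by
  have e1 : ∀ᶠ k in nhds x, 0 < a + k * c :=
    (show Continuous fun k : ℝ => a + k * c by fun_prop).continuousAt.eventually_const_lt h1
  have e2 : ∀ᶠ k in nhds x, 0 < b + k * d :=
    (show Continuous fun k : ℝ => b + k * d by fun_prop).continuousAt.eventually_const_lt h2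
  by_cases hx : x = 0
  · subst hx
    exact (eventually_mem_nhdsWithin.and
      ((e1.and e2).filter_mono (nhdsWithin_le_nhds (s := {0}ᶜ)))).exists
  · exact ⟨x, hx, h1, h2⟩

theorem exists_real_gain_hurwitz_of_exists_complex_gain
    (D P : Polynomial ℝ) (hD : D.Monic) (hDdeg : D.degree = 2) (hP : P.degree ≤ 1)
    (h : ∃ z : ℂ,
      ∀ μ : ℂ, (D.map (algebraMap ℝ ℂ) + Polynomial.C z * P.map (algebraMap ℝ ℂ)).IsRoot μ →
        μ.re < 0) :
    ∃ k : ℝ, k ≠ 0 ∧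
      ∀ μ : ℂ, ((D + Polynomial.C k * P).map (algebraMap ℝ ℂ)).IsRoot μ → μ.re < 0 := by
  obtain ⟨z, hz⟩ := h
  have hDn : D.natDegree = 2 := Polynomial.natDegree_eq_of_degree_eq_some hDdeg
  have hD2 : D.coeff 2 = 1 := by rw [← hDn]; exact hD
  have hDev (μ : ℂ) : (D.map (algebraMap ℝ ℂ)).eval μ =
      μ ^ 2 + (D.coeff 1 : ℂ) * μ + (D.coeff 0 : ℂ) := by
    rw [Polynomial.eval_map, Polynomial.eval₂_eq_sum_range, hDn]
    simp [Finset.sum_range_succ, hD2]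
    ring
  have hPev (μ : ℂ) : (P.map (algebraMap ℝ ℂ)).eval μ =
      (P.coeff 1 : ℂ) * μ + (P.coeff 0 : ℂ) := by
    rw [Polynomial.eq_X_add_C_of_degree_le_one hP]
    simp
  generalize D.coeff 1 = a at hDev
  generalize D.coeff 0 = b at hDev
  generalize P.coeff 1 = c at hPev
  generalize P.coeff 0 = d at hPev
  obtain ⟨k, hk, hk1, hk0⟩ : ∃ k : ℝ, k ≠ 0 ∧ 0 < a + k * c ∧ 0 < b + k * d := by
    rcases lt_or_ge 0 (c * d) with hcd | hcd
    · rcases pos_and_pos_or_neg_and_neg_of_mul_pos hcd with ⟨hc, hd⟩ | ⟨hc, hd⟩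
      · obtain ⟨k, hk, h1, h2⟩ := exists_pos_add_mul_pos a b hc hd
        exact ⟨k, hk.ne', h1, h2⟩
      · obtain ⟨k, hk, h1, h2⟩ := exists_pos_add_mul_pos a b (neg_pos.2 hc) (neg_pos.2 hd)
        exact ⟨-k, neg_ne_zero.2 hk.ne', by linarith, by linarith⟩
    · have hpos := quadratic_coeff_re_pos (B := a + z * c) (C := b + z * d)
        (fun μ hμ => hz μ (by
          simp only [Polynomial.IsRoot.def, Polynomial.eval_add, Polynomial.eval_mul,
            Polynomial.eval_C, hDev, hPev]
          linear_combination hμ))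
        (by
          simp only [Complex.add_im, Complex.ofReal_im, Complex.im_mul_ofReal, zero_add]
          nlinarith [mul_nonneg (sq_nonneg z.im) (neg_nonneg.2 hcd)])
      simp only [Complex.add_re, Complex.ofReal_re, Complex.re_mul_ofReal] at hpos
      exact exists_ne_zero_add_mul_pos hpos.1 hpos.2
  refine ⟨k, hk, fun μ hμ => re_neg_of_quadratic_eq_zero hk1 hk0 ?_⟩
  simp only [Polynomial.IsRoot.def, Polynomial.map_add, Polynomial.map_mul, Polynomial.map_C,
    Polynomial.eval_add, Polynomial.eval_mul, Polynomial.eval_C, hDev, hPev,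
    Complex.coe_algebraMap] at hμ
  push_cast
  linear_combination hμ
end
end

section
/- Let d > 0 be a real number, and let A = [[0,1],[−1,0]], B = [[0],[1]], C = [[0, d]] (the harmonic oscillator with output y = d·x₂). For every real k and every complex λ, the complex 2×2 matrix A − k·λ·B·C is Hurwitz if and only if k·Re(λ) > 0. -/
open Matrix Filter
open scoped Kronecker

noncomputable section

theorem Complex.re_neg_iff_of_sq_add_mul_add_one_eq_zero {c z : ℂ}
    (h : z ^ 2 + c * z + 1 = 0) : z.re < 0 ↔ 0 < c.re := by
  have hz : z ≠ 0 := by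
    rintro rfl
    simp at h
  have hpos : 0 < z.re * z.re + z.im * z.im := Complex.normSq_pos.mpr hz
  have hre := congrArg Complex.re h
  have him := congrArg Complex.im h
  simp only [sq, Complex.add_re, Complex.mul_re, Complex.one_re, Complex.zero_re] at hre
  simp only [sq, Complex.add_im, Complex.mul_im, Complex.one_im, Complex.zero_im] at him
  have key : -z.re * (z.re * z.re + z.im * z.im + 1) =
      c.re * (z.re * z.re + z.im * z.im) := by
    linear_combination -z.re * hre - z.im * him
  rw [← neg_pos, ← mul_pos_iff_of_pos_right (add_pos hpos one_pos), key,
    mul_pos_iff_of_pos_right hpos]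

theorem mem_spectrum_oscillator_iff (d : ℝ) (g μ : ℂ) :
    μ ∈ spectrum ℂ (cplx !![0, 1; -1, 0] - g • (cplx !![0; 1] * cplx !![0, d])) ↔
      μ ^ 2 + (g * d) * μ + 1 = 0 := by
  rw [spectrum.mem_iff, Matrix.isUnit_iff_isUnit_det, isUnit_iff_ne_zero, not_not,
    Matrix.det_fin_two]
  simp only [cplx, Matrix.sub_apply, Matrix.smul_apply, Matrix.mul_apply,
    Matrix.algebraMap_matrix_apply, Matrix.map_apply]
  simp
  ring_nf

theorem harmonic_oscillator_velocity_output_hurwitz_iff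
    (d : ℝ) (hd : 0 < d) (k : ℝ) (l : ℂ) :
    IsHurwitz (cplx !![0, 1; -1, 0] - ((k : ℂ) * l) • (cplx !![0; 1] * cplx !![0, d])) ↔
      0 < k * l.re := by
  have hc : ((k : ℂ) * l * d).re = k * l.re * d := by simp
  have hsign (μ : ℂ) (hμ : μ ∈ spectrum ℂ
      (cplx !![0, 1; -1, 0] - ((k : ℂ) * l) • (cplx !![0; 1] * cplx !![0, d]))) :
      μ.re < 0 ↔ 0 < k * l.re := by
    rw [Complex.re_neg_iff_of_sq_add_mul_add_one_eq_zero
      ((mem_spectrum_oscillator_iff d _ μ).mp hμ), hc, mul_pos_iff_of_pos_right hd]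
  obtain ⟨μ, hμ⟩ := spectrum.nonempty_of_isAlgClosed_of_finiteDimensional ℂ
    (cplx !![0, 1; -1, 0] - ((k : ℂ) * l) • (cplx !![0; 1] * cplx !![0, d]))
  exact ⟨fun h => (hsign μ hμ).mp (h μ hμ), fun h ν hν => (hsign ν hν).mpr h⟩
end
end
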